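/- arXiv:1010.5699 — 2 statements merged into one kernel-verified Lean document; each statement's English description precedes it below -/
import Mathlib

section
/- Let G=(V,E) be a finite multigraph with a partition {B,R} of V, d≥3 an integer, D=binom(d+1,2), and f(F)=D(|V(F)|−1)−|R(F)|. If F⊆E is a nontrivial M-connected set in the count matroid M_f(G,{B,R}) (i.e., |F|≥2 and for every pair e,e'∈F some circuit of M_f contained in F contains both e and e'), then r_f(F) = f(F). -/
/- STATEMENT 14: a nontrivial M-connected set `F` of the count matroid `M_f(G,{B,R})`
satisfies `r_f(F) = f(F)`. -/

set_option synthInstance.maxHeartbeats 1000000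
set_option maxHeartbeats 1000000

open scoped Classical

noncomputable section

/-- The set `V(F)` of vertices spanned by an edge set `F` in a multigraph whose edges `e : ε`
have endpoint pairs `π e : Sym2 V`. -/
def VF {V ε : Type} [Fintype V] (π : ε → Sym2 V) (F : Finset ε) : Finset V :=
  Finset.univ.filter (fun v => ∃ e ∈ F, v ∈ π e)

/-- The count function `f(F) = D·|V(F)| − D − |R(F)|`. -/
def fCnt {V ε : Type} [Fintype V] (D : ℕ) (π : ε → Sym2 V) (R : Finset V)
    (F : Finset ε) : ℤ :=
  (D : ℤ) * (VF π F).card - D - ((VF π F) ∩ R).card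

/-- Independence in the count matroid `M_f`: `|F'| ≤ f(F')` for all nonempty `F' ⊆ F`. -/
def CIndep {V ε : Type} [Fintype V] (D : ℕ) (π : ε → Sym2 V) (R : Finset V)
    (F : Finset ε) : Prop :=
  ∀ F' ⊆ F, F'.Nonempty → (F'.card : ℤ) ≤ fCnt D π R F'

/-- The rank function of the count matroid `M_f`: the maximum size of an independent subset. -/
def cRank {V ε : Type} [Fintype V] (D : ℕ) (π : ε → Sym2 V) (R : Finset V)
    (F : Finset ε) : ℕ :=
  sSup {n : ℕ | ∃ F' ⊆ F, CIndep D π R F' ∧ F'.card = n}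

/-- A circuit of the count matroid: a minimal dependent set. -/
def CCircuit {V ε : Type} [Fintype V] (D : ℕ) (π : ε → Sym2 V) (R : Finset V)
    (C : Finset ε) : Prop :=
  ¬ CIndep D π R C ∧ ∀ C' ⊂ C, CIndep D π R C'

/-- `F` is M-connected: every pair of its elements lies on a common circuit contained in `F`
(singletons and the empty set count as M-connected). -/
def MConn {V ε : Type} [Fintype V] (D : ℕ) (π : ε → Sym2 V) (R : Finset V)
    (F : Finset ε) : Prop :=
  F.card ≤ 1 ∨ ∀ e ∈ F, ∀ e' ∈ F, ∃ C ⊆ F, CCircuit D π R C ∧ e ∈ C ∧ e' ∈ C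

/-- `X` is an M-connected component of the count matroid restricted to the ground set `G`:
a maximal M-connected subset of `G`. -/
def MConnComp {V ε : Type} [Fintype V] (D : ℕ) (π : ε → Sym2 V) (R : Finset V)
    (G X : Finset ε) : Prop :=
  X ⊆ G ∧ MConn D π R X ∧ ∀ Y ⊆ G, MConn D π R Y → X ⊆ Y → Y = X

/-- `P` is a partition of `F` into nonempty parts. -/
def IsPartitionOf {ε : Type} [DecidableEq ε] (F : Finset ε) (P : Finset (Finset ε)) : Prop :=
  (∀ p ∈ P, p.Nonempty) ∧ (P : Set (Finset ε)).PairwiseDisjoint id ∧ P.biUnion id = F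

/-- The induced polymatroid function `f̂(F) = min Σᵢ f(Fᵢ)` over partitions of `F` into
nonempty parts (with `f̂(∅) = 0`). -/
def fHat {V ε : Type} [Fintype V] [DecidableEq ε] (D : ℕ) (π : ε → Sym2 V) (R : Finset V)
    (F : Finset ε) : ℤ :=
  sInf {s : ℤ | ∃ P : Finset (Finset ε), IsPartitionOf F P ∧ s = ∑ p ∈ P, fCnt D π R p}

/-- `F` is P-connected in the polymatroid `(E, f̂)`: no partition of `F` into at least two
nonempty parts satisfies `f̂(F) = Σᵢ f̂(Fᵢ)`. -/
def PConn {V ε : Type} [Fintype V] [DecidableEq ε] (D : ℕ) (π : ε → Sym2 V) (R : Finset V)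
    (F : Finset ε) : Prop :=
  F.Nonempty ∧ ∀ P : Finset (Finset ε), IsPartitionOf F P → 2 ≤ P.card →
    fHat D π R F ≠ ∑ p ∈ P, fHat D π R p

/-- `C` is a P-connected component of the polymatroid on the ground set `G`: a maximal
P-connected subset of `G`. -/
def PConnComp {V ε : Type} [Fintype V] [DecidableEq ε] (D : ℕ) (π : ε → Sym2 V) (R : Finset V)
    (G C : Finset ε) : Prop :=
  C ⊆ G ∧ PConn D π R C ∧ ∀ C' ⊆ G, PConn D π R C' → C ⊆ C' → C' = C

/-- The multiplicity `f({e}) = D − |R({e})|` of an edge in `f∘G`. -/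
def fMult {V ε : Type} [Fintype V] (D : ℕ) (π : ε → Sym2 V) (R : Finset V) (e : ε) : ℕ :=
  D - ((VF π ({e} : Finset ε)) ∩ R).card

/-- The set `f∘F` of all copies of edges of `F` in `f∘G`; copies of `e` are indexed by
`i : Fin D` with `i < f({e})`. -/
def fCopy {V ε : Type} [Fintype V] [DecidableEq ε] (D : ℕ) (π : ε → Sym2 V) (R : Finset V)
    (F : Finset ε) : Finset (ε × Fin D) :=
  F.biUnion (fun e =>
    ({e} : Finset ε) ×ˢ (Finset.univ.filter (fun i : Fin D => (i : ℕ) < fMult D π R e)))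

end

open scoped Classical in
noncomputable def gU {V : Type} (D : ℕ) (R U : Finset V) : ℤ := (D : ℤ) * U.card - D - (U ∩ R).card

open scoped Classical in
lemma gU_mod {V : Type} (D : ℕ) (R U W : Finset V) :
    gU D R (U ∪ W) + gU D R (U ∩ W) = gU D R U + gU D R W := by
  unfold gU
  have h1 := Finset.card_union_add_card_inter U W
  have h2 := Finset.card_union_add_card_inter (U ∩ R) (W ∩ R)
  have e1 : (U ∩ R) ∪ (W ∩ R) = (U ∪ W) ∩ R := by ext; simp; tauto
  have e2 : (U ∩ R) ∩ (W ∩ R) = (U ∩ W) ∩ R := by ext; simp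
  rw [e1, e2] at h2
  have h1' : ((U ∪ W).card : ℤ) + (U ∩ W).card = U.card + W.card := by exact_mod_cast h1
  have h2' : (((U ∪ W) ∩ R).card : ℤ) + ((U ∩ W) ∩ R).card = (U ∩ R).card + (W ∩ R).card := by
    exact_mod_cast h2
  linear_combination (D : ℤ) * h1' - h2'

open scoped Classical in
lemma gU_gap {V : Type} (D : ℕ) (hD : 2 ≤ D) (R U W : Finset V) (h : U ⊆ W) :
    gU D R U + (W \ U).card ≤ gU D R W := by
  have h1 := gU_mod D R U (W \ U)
  rw [Finset.union_sdiff_of_subset h, Finset.inter_sdiff_self] at h1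
  have h2 : ((W \ U) ∩ R).card ≤ (W \ U).card := Finset.card_le_card Finset.inter_subset_left
  unfold gU at *
  simp at h1
  zify at h2 hD
  nlinarith

lemma gU_mono {V : Type} (D : ℕ) (hD : 2 ≤ D) (R U W : Finset V) (h : U ⊆ W) :
    gU D R U ≤ gU D R W := by
  classical
  have := gU_gap D hD R U W h
  omega

lemma gU_eq {V : Type} (D : ℕ) (hD : 2 ≤ D) (R U W : Finset V) (h : U ⊆ W)
    (hg : gU D R W ≤ gU D R U) : W ⊆ U := by
  classical
  have := gU_gap D hD R U W h
  have h0 : (W \ U).card = 0 := by omega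
  rw [Finset.card_eq_zero] at h0
  exact Finset.sdiff_eq_empty_iff_subset.mp h0

lemma fCnt_eq {V ε : Type} [Fintype V] (D : ℕ) (π : ε → Sym2 V) (R : Finset V) (F : Finset ε) :
    fCnt D π R F = gU D R (VF π F) := rfl

lemma VF_mono {V ε : Type} [Fintype V] (π : ε → Sym2 V) {F G : Finset ε} (h : F ⊆ G) :
    VF π F ⊆ VF π G := by
  intro v hv
  simp only [VF, Finset.mem_filter, Finset.mem_univ, true_and] at *
  obtain ⟨e, he, hv⟩ := hv
  exact ⟨e, h he, hv⟩

lemma VF_sub {V ε : Type} [Fintype V] (π : ε → Sym2 V) {F : Finset ε} {U : Finset V}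
    (h : ∀ e ∈ F, VF π {e} ⊆ U) : VF π F ⊆ U := by
  intro v hv
  simp only [VF, Finset.mem_filter, Finset.mem_univ, true_and] at hv
  obtain ⟨e, he, hv⟩ := hv
  apply h e he
  simp [VF, hv]

lemma g_edge {V ε : Type} [Fintype V] (D : ℕ) (hD : 6 ≤ D) (π : ε → Sym2 V)
    (hπ : ∀ e : ε, ¬ (π e).IsDiag) (R : Finset V) (e : ε) :
    1 ≤ gU D R (VF π {e}) := by
  classical
  have hc : (VF π {e}).card = 2 := by
    have h := hπ e
    revert h
    generalize hp : π e = p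
    induction p with
    | _ a b =>
      intro h
      have : VF π {e} = {a, b} := by
        ext v; simp [VF, hp]
      rw [this]
      exact Finset.card_pair (by simpa using h)
  have h2 : (VF π {e} ∩ R).card ≤ (VF π {e}).card := Finset.card_le_card Finset.inter_subset_left
  unfold gU
  have h3 : ((@Inter.inter _ (@Finset.instInter _ (fun a b => Classical.propDecidable (a = b))) (VF π {e}) R).card) ≤ (VF π {e}).card := Finset.card_le_card (by intro v hv; simp at hv; exact hv.1)
  rw [hc] at *
  zify at h3 hD
  push_cast
  linarith

/-- Tight subsets of B. -/
def Tg {V ε : Type} [Fintype V] (D : ℕ) (π : ε → Sym2 V) (R : Finset V)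
    (B T : Finset ε) : Prop := T ⊆ B ∧ T.Nonempty ∧ gU D R (VF π T) = T.card

/-- Maximal tight. -/
def MTg {V ε : Type} [Fintype V] (D : ℕ) (π : ε → Sym2 V) (R : Finset V)
    (B T : Finset ε) : Prop := Tg D π R B T ∧ ∀ T', Tg D π R B T' → T ⊆ T' → T' = T

section
variable {V ε : Type} [Fintype V] (D : ℕ) (hD : 6 ≤ D) (π : ε → Sym2 V)
    (hπ : ∀ e : ε, ¬ (π e).IsDiag) (R : Finset V)

lemma VF_union [DecidableEq ε] [DecidableEq V] (F G : Finset ε) :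
    VF π (F ∪ G) = VF π F ∪ VF π G := by
  ext v
  simp only [VF, Finset.mem_filter, Finset.mem_univ, true_and, Finset.mem_union]
  constructor
  · rintro ⟨e, he | he, hv⟩
    · exact Or.inl ⟨e, he, hv⟩
    · exact Or.inr ⟨e, he, hv⟩
  · rintro (⟨e, he, hv⟩ | ⟨e, he, hv⟩)
    · exact ⟨e, Or.inl he, hv⟩
    · exact ⟨e, Or.inr he, hv⟩

open scoped Classical in
lemma tg_max {B T : Finset ε} (h : Tg D π R B T) : ∃ M, MTg D π R B M ∧ T ⊆ M := by
  obtain ⟨M, hM, hmax⟩ := Finset.exists_max_image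
    (B.powerset.filter (fun M => Tg D π R B M ∧ T ⊆ M)) Finset.card
    ⟨T, by simp [h, h.1]⟩
  simp only [Finset.mem_filter, Finset.mem_powerset] at hM hmax
  refine ⟨M, ⟨hM.2.1, fun T' hT' hs => ?_⟩, hM.2.2⟩
  exact (Finset.eq_of_subset_of_card_le hs (hmax T' ⟨hT'.1, hT', hM.2.2.trans hs⟩)).symm

include hD in
open scoped Classical in
lemma tg_union {B T S : Finset ε} (hB : CIndep D π R B) (hT : Tg D π R B T) (hS : Tg D π R B S)
    (hne : (T ∩ S).Nonempty) : Tg D π R B (T ∪ S) := by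
  refine ⟨Finset.union_subset hT.1 hS.1, hT.2.1.mono Finset.subset_union_left, ?_⟩
  have h1 := gU_mod D R (VF π T) (VF π S)
  have h2 : gU D R (VF π (T ∩ S)) ≤ gU D R (VF π T ∩ VF π S) :=
    gU_mono D (by omega) R _ _ (Finset.subset_inter (VF_mono π Finset.inter_subset_left)
      (VF_mono π Finset.inter_subset_right))
  have h3 := hB (T ∩ S) (Finset.inter_subset_left.trans hT.1) hne
  have h4 := hB (T ∪ S) (Finset.union_subset hT.1 hS.1) (hT.2.1.mono Finset.subset_union_left)
  have h5 := Finset.card_union_add_card_inter T S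
  have h6 := hT.2.2
  have h7 := hS.2.2
  rw [fCnt_eq] at h3 h4
  rw [← VF_union] at h1
  omega

include hD in
open scoped Classical in
lemma mtg_eq {B T S : Finset ε} (hB : CIndep D π R B) (hT : MTg D π R B T) (hS : Tg D π R B S)
    (hne : (T ∩ S).Nonempty) : S ⊆ T := by
  rw [← hT.2 _ (tg_union D hD π R hB hT.1 hS hne) Finset.subset_union_left]
  exact Finset.subset_union_right

include hD hπ in
open scoped Classical in
lemma mtg_span {B T S : Finset ε} (hB : CIndep D π R B) (hT : MTg D π R B T)
    (hS : MTg D π R B S) (e : ε) (h1 : VF π {e} ⊆ VF π T) (h2 : VF π {e} ⊆ VF π S) : S ⊆ T := by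
  by_cases hne : (T ∩ S).Nonempty
  · exact mtg_eq D hD π R hB hT hS.1 hne
  exfalso
  have hdj : T ∩ S = ∅ := Finset.not_nonempty_iff_eq_empty.mp hne
  have a1 := gU_mod D R (VF π T) (VF π S)
  have a2 : gU D R (VF π {e}) ≤ gU D R (VF π T ∩ VF π S) :=
    gU_mono D (by omega) R _ _ (Finset.subset_inter h1 h2)
  have a3 := g_edge D hD π hπ R e
  have a4 := hB (T ∪ S) (Finset.union_subset hT.1.1 hS.1.1)
    (hT.1.2.1.mono Finset.subset_union_left)
  have a5 := Finset.card_union_add_card_inter T S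
  rw [hdj, Finset.card_empty] at a5
  have h6 := hT.1.2.2
  have h7 := hS.1.2.2
  rw [fCnt_eq] at a4
  rw [← VF_union] at a1
  omega

include hD hπ in
open scoped Classical in
lemma span_of_dep {B : Finset ε} (hB : CIndep D π R B) (e : ε)
    (he : ¬ CIndep D π R (insert e B)) : ∃ T, MTg D π R B T ∧ VF π {e} ⊆ VF π T := by
  suffices h : ∃ T, Tg D π R B T ∧ VF π {e} ⊆ VF π T by
    obtain ⟨T, hT, hs⟩ := h
    obtain ⟨M, hM, hTM⟩ := tg_max D π R hT
    exact ⟨M, hM, hs.trans (VF_mono π hTM)⟩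
  unfold CIndep at he
  push Not at he
  obtain ⟨F', hF', hne, hlt⟩ := he
  have heF : e ∈ F' := by
    by_contra hn
    have := hB F' (by rwa [Finset.subset_insert_iff_of_notMem hn] at hF') hne
    omega
  have hTB : F'.erase e ⊆ B := by rwa [← Finset.subset_insert_iff]
  have hc := Finset.card_erase_add_one heF
  have hTne : (F'.erase e).Nonempty := by
    by_contra hn
    rw [Finset.not_nonempty_iff_eq_empty] at hn
    have : F' = {e} := by
      rw [← Finset.insert_erase heF, hn]; rfl
    subst this
    have := g_edge D hD π hπ R e
    rw [fCnt_eq] at hlt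
    simp at hlt
    omega
  have h1 := hB _ hTB hTne
  have h2 := gU_mono D (by omega) R _ _ (VF_mono π (Finset.erase_subset e F'))
  rw [fCnt_eq] at *
  refine ⟨F'.erase e, ⟨hTB, hTne, by omega⟩, ?_⟩
  refine (VF_mono π (Finset.singleton_subset_iff.mpr heF)).trans ?_
  exact gU_eq D (by omega) R _ _ (VF_mono π (Finset.erase_subset e F')) (by omega)

include hD in
open scoped Classical in
lemma circ_step {B C : Finset ε} (hB : CIndep D π R B)
    (hC : ∀ C' ⊂ C, CIndep D π R C')
    (hspan : ∀ e ∈ C, e ∉ B → ∃ T, MTg D π R B T ∧ VF π {e} ⊆ VF π T)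
    (hno : ¬ ∃ T, MTg D π R B T ∧ ∀ e ∈ C, VF π {e} ⊆ VF π T) :
    ∀ n : ℕ, ∀ X Y : Finset ε, (Y \ B).card = n → X ⊆ B → Y ⊆ C → Disjoint X Y →
      (X ∪ Y).Nonempty →
      (∀ T, MTg D π R B T → (T ∩ X).Nonempty → T ⊆ X) →
      (∀ T, MTg D π R B T → T ⊆ X → ∀ y ∈ Y, ¬ VF π {y} ⊆ VF π T) →
      gU D R (VF π (X ∪ Y)) < X.card + Y.card → False := by
  intro n
  induction n using Nat.strong_induction_on with
  | _ n ih =>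
  intro X Y hn hXB hYC hdis hne hsat hnsp hlt
  by_cases hYB : Y ⊆ B
  · have := hB (X ∪ Y) (Finset.union_subset hXB hYB) hne
    rw [Finset.card_union_of_disjoint hdis, fCnt_eq] at this
    push_cast at this
    omega
  obtain ⟨e, heY, heB⟩ := Finset.not_subset.mp hYB
  obtain ⟨T, hT, heT⟩ := hspan e (hYC heY) heB
  set Y1 := Y.filter (fun y => VF π {y} ⊆ VF π T) with hY1
  have heY1 : e ∈ Y1 := by simp [hY1, heY, heT]
  have hTX : Disjoint X T := by
    rw [Finset.disjoint_iff_inter_eq_empty, Finset.inter_comm]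
    by_contra h
    exact hnsp T hT (hsat T hT (Finset.nonempty_iff_ne_empty.mpr h)) e heY heT
  have hY1Y : Y1 ⊆ Y := Finset.filter_subset _ _
  have hY1C : Y1 ⊂ C := by
    refine (Finset.ssubset_iff_subset_ne).mpr ⟨hY1Y.trans hYC, fun h => hno ⟨T, hT, ?_⟩⟩
    intro y hy
    rw [← h] at hy
    exact (Finset.mem_filter.mp hy).2
  have b1 := hC Y1 hY1C Y1 (Finset.Subset.refl _) ⟨e, heY1⟩
  rw [fCnt_eq] at b1
  have b2 : gU D R (VF π Y1) ≤ gU D R (VF π (X ∪ Y) ∩ VF π T) := by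
    refine gU_mono D (by omega) R _ _ (Finset.subset_inter ?_ ?_)
    · exact VF_mono π (hY1Y.trans Finset.subset_union_right)
    · exact VF_sub π (fun y hy => (Finset.mem_filter.mp hy).2)
  have b3 := gU_mod D R (VF π (X ∪ Y)) (VF π T)
  rw [← VF_union] at b3
  have b4 : gU D R (VF π ((X ∪ T) ∪ (Y \ Y1))) ≤ gU D R (VF π ((X ∪ Y) ∪ T)) := by
    refine gU_mono D (by omega) R _ _ (VF_mono π ?_)
    intro x; simp; tauto
  have b5 := hT.1.2.2
  have b6 := Finset.card_union_of_disjoint hTX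
  have b7 := Finset.card_sdiff_add_card_eq_card hY1Y
  refine ih ((Y \ Y1) \ B).card ?_ (X ∪ T) (Y \ Y1) rfl (Finset.union_subset hXB hT.1.1)
    (Finset.sdiff_subset.trans hYC) ?_ ?_ ?_ ?_ ?_
  · rw [← hn]
    apply Finset.card_lt_card
    refine (Finset.ssubset_iff_of_subset ?_).mpr ⟨e, ?_, ?_⟩
    · exact Finset.sdiff_subset_sdiff Finset.sdiff_subset (Finset.Subset.refl _)
    · simp [heY, heB]
    · simp [heY1]
  · rw [Finset.disjoint_left] at hdis ⊢
    intro x hx hxy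
    simp only [Finset.mem_sdiff, Finset.mem_union] at hx hxy
    rcases hx with hx | hx
    · exact hdis hx hxy.1
    · exact hxy.2 (Finset.mem_filter.mpr
        ⟨hxy.1, VF_mono π (Finset.singleton_subset_iff.mpr hx)⟩)
  · obtain ⟨t, ht⟩ := hT.1.2.1
    exact ⟨t, by simp [ht]⟩
  · intro T' hT' hne'
    by_cases h : (T' ∩ X).Nonempty
    · exact (hsat T' hT' h).trans Finset.subset_union_left
    · refine (mtg_eq D hD π R hB hT hT'.1 ?_).trans Finset.subset_union_right
      obtain ⟨x, hx⟩ := hne'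
      simp only [Finset.mem_inter, Finset.mem_union] at hx
      rcases hx.2 with hx2 | hx2
      · exact absurd ⟨x, Finset.mem_inter.mpr ⟨hx.1, hx2⟩⟩ h
      · exact ⟨x, Finset.mem_inter.mpr ⟨hx2, hx.1⟩⟩
  · intro T' hT' hsub y hy hyT
    simp only [Finset.mem_sdiff] at hy
    by_cases h : (T ∩ T').Nonempty
    · have := mtg_eq D hD π R hB hT hT'.1 h
      exact hy.2 (Finset.mem_filter.mpr ⟨hy.1, hyT.trans (VF_mono π this)⟩)
    · refine hnsp T' hT' ?_ y hy.1 hyT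
      intro t ht
      rcases Finset.mem_union.mp (hsub ht) with h1 | h1
      · exact h1
      · exact absurd ⟨t, Finset.mem_inter.mpr ⟨h1, ht⟩⟩ h
  · omega

include hD in
open scoped Classical in
lemma circ_span {B C : Finset ε} (hB : CIndep D π R B) (hC : CCircuit D π R C)
    (hspan : ∀ e ∈ C, e ∉ B → ∃ T, MTg D π R B T ∧ VF π {e} ⊆ VF π T) :
    ∃ T, MTg D π R B T ∧ ∀ e ∈ C, VF π {e} ⊆ VF π T := by
  by_contra hno
  obtain ⟨h1, h2⟩ := hC
  have hd := h1
  unfold CIndep at h1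
  push Not at h1
  obtain ⟨F', hF', hne, hlt⟩ := h1
  have hFC : F' = C := by
    by_contra hn
    have := h2 F' (Finset.ssubset_iff_subset_ne.mpr ⟨hF', hn⟩) F' (Finset.Subset.refl _) hne
    omega
  subst hFC
  refine circ_step D hD π R hB h2 hspan hno _ ∅ F' rfl (by simp) (Finset.Subset.refl _)
    (by simp) (by simpa using hne) (by simp) ?_ ?_
  · intro T hT hs
    obtain ⟨t, ht⟩ := hT.1.2.1
    exact absurd (hs ht) (by simp)
  · rw [fCnt_eq] at hlt
    simpa using hlt

include hD hπ in
open scoped Classical in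
lemma main_aux (F : Finset ε) (hF2 : 2 ≤ F.card) (hconn : MConn D π R F) :
    (cRank D π R F : ℤ) = fCnt D π R F := by
  have hempty : CIndep D π R (∅ : Finset ε) := by
    intro F' h hne
    rw [Finset.subset_empty] at h
    simp [h] at hne
  obtain ⟨B, hB, hmax⟩ := Finset.exists_max_image
    (F.powerset.filter (fun M => CIndep D π R M)) Finset.card ⟨∅, by simp [hempty]⟩
  simp only [Finset.mem_filter, Finset.mem_powerset] at hB hmax
  obtain ⟨hBF, hB⟩ := hB
  have hr : cRank D π R F = B.card := by
    apply IsGreatest.csSup_eq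
    refine ⟨⟨B, hBF, hB, rfl⟩, ?_⟩
    rintro n ⟨F', h1, h2, rfl⟩
    exact hmax F' ⟨h1, h2⟩
  have hspan : ∀ e ∈ F, e ∉ B → ∃ T, MTg D π R B T ∧ VF π {e} ⊆ VF π T := by
    intro e he heB
    apply span_of_dep D hD π hπ R hB
    intro hi
    have := hmax _ ⟨Finset.insert_subset he hBF, hi⟩
    rw [Finset.card_insert_of_notMem heB] at this
    omega
  rcases hconn with h | hconn
  · omega
  obtain ⟨e0, he0⟩ : F.Nonempty := Finset.card_pos.mp (by omega)
  have key : ∀ e ∈ F, ∃ T, MTg D π R B T ∧ VF π {e0} ⊆ VF π T ∧ VF π {e} ⊆ VF π T := by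
    intro e he
    obtain ⟨C, hCF, hC, h0, h1⟩ := hconn e0 he0 e he
    obtain ⟨T, hT, hs⟩ := circ_span D hD π R hB hC (fun e he => hspan e (hCF he))
    exact ⟨T, hT, hs _ h0, hs _ h1⟩
  obtain ⟨T, hT, hT0, -⟩ := key e0 he0
  have hFT : VF π F ⊆ VF π T := by
    apply VF_sub
    intro e he
    obtain ⟨S, hS, hS0, hSe⟩ := key e he
    exact hSe.trans (VF_mono π (mtg_span D hD π hπ R hB hT hS e0 hT0 hS0))
  have c1 := gU_mono D (by omega) R _ _ hFT
  have c2 := hT.1.2.2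
  have c3 := Finset.card_le_card hT.1.1
  have c4 := hB B (Finset.Subset.refl _) (hT.1.2.1.mono hT.1.1)
  have c5 := gU_mono D (by omega) R _ _ (VF_mono π hBF)
  rw [hr]
  rw [fCnt_eq] at *
  omega

end

theorem statement_14
    (V E : Type) [Fintype V] [Fintype E] [DecidableEq V] [DecidableEq E]
    (π : E → Sym2 V) (hπ : ∀ e : E, ¬ (π e).IsDiag)
    (B R : Finset V) (hdisj : Disjoint B R) (hcov : B ∪ R = Finset.univ)
    (d D : ℕ) (hd : 3 ≤ d) (hD : D = (d + 1).choose 2)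
    (F : Finset E) (hF2 : 2 ≤ F.card) (hconn : MConn D π R F) :
    (cRank D π R F : ℤ) = fCnt D π R F := by
  have h6 : 6 ≤ D := by
    rw [hD]
    calc 6 = (3 + 1).choose 2 := by decide
      _ ≤ (d + 1).choose 2 := Nat.choose_le_choose 2 (by omega)
  exact main_aux D h6 π hπ R F hF2 hconn
end

section
/- Let G=(V,E) be a finite multigraph with a partition {B,R} of V, d≥3 an integer, D=binom(d+1,2), and f(F)=D(|V(F)|−1)−|R(F)|. If F⊆E is a nontrivial M-connected set in the count matroid M_f(G,{B,R}), then the closure of F, namely {e∈E : r_f(F∪{e}) = r_f(F)}, equals the set of edges of G both of whose endpoints lie in V(F). In particular, if F is a nontrivial M-connected component of M_f(G,{B,R}), then every edge of G with both endpoints in V(F) belongs to F. -/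
/- STATEMENT 15: the closure of a nontrivial M-connected set `F` in `M_f(G,{B,R})` is the
set of edges with both endpoints in `V(F)`; in particular a nontrivial M-connected
component is an induced subgraph. -/

set_option synthInstance.maxHeartbeats 1000000
set_option maxHeartbeats 1000000

open scoped Classical

theorem strong_elim_aux {E : Type} [DecidableEq E] (Circ : Finset E → Prop)
    (anti : ∀ A B, Circ A → Circ B → A ⊆ B → A = B)
    (weak : ∀ A B x, Circ A → Circ B → A ≠ B → x ∈ A → x ∈ B →
      ∃ C ⊆ (A ∪ B).erase x, Circ C) :
    ∀ n : ℕ, ∀ A B x y, (A ∪ B).card ≤ n → Circ A → Circ B → x ∈ A → x ∈ B → y ∈ A → y ∉ B →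
      ∃ C ⊆ (A ∪ B).erase x, Circ C ∧ y ∈ C := by
  intro n
  induction n with
  | zero =>
    intro A B x y hn hA hB hxA
    have : (A ∪ B) = ∅ := Finset.card_eq_zero.mp (by omega)
    have hx : x ∈ A ∪ B := Finset.mem_union_left _ hxA
    simp [this] at hx
  | succ n ih =>
    intro A B x y hn hA hB hxA hxB hyA hyB
    obtain ⟨C, hC, hCc⟩ := weak A B x hA hB (by rintro rfl; exact hyB hyA) hxA hxB
    by_cases hyC : y ∈ C
    · exact ⟨C, hC, hCc, hyC⟩
    have hCA : ¬ C ⊆ A := by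
      intro h
      have := anti _ _ hCc hA h
      exact hyC (this ▸ hyA)
    obtain ⟨g, hgC, hgA⟩ := Finset.not_subset.mp hCA
    have hxC : x ∉ C := fun h => by simpa using hC h
    have hgB : g ∈ B := by
      have := hC hgC
      simp only [Finset.mem_erase, Finset.mem_union] at this
      tauto
    have hlt : ∀ Z : Finset E, ∀ z ∈ A ∪ B, Z ⊆ (A ∪ B).erase z → Z.card ≤ n := by
      intro Z z hz hZ
      have h1 := Finset.card_le_card hZ
      rw [Finset.card_erase_of_mem hz] at h1
      omega
    obtain ⟨C4, h4, h4c, hx4⟩ := ih B C g x (hlt _ y (by simp [hyA]) (by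
        intro z hz
        simp only [Finset.mem_union, Finset.mem_erase] at hz ⊢
        refine ⟨by rintro rfl; tauto, ?_⟩
        rcases hz with h | h
        · exact Or.inr h
        · simpa using Finset.mem_of_mem_erase (hC h))) hB hCc hgB hgC hxB hxC
    have hsub4 : C4 ⊆ A ∪ B := by
      intro z hz
      have := h4 hz
      simp only [Finset.mem_union, Finset.mem_erase] at this ⊢
      rcases this.2 with h | h
      · exact Or.inr h
      · simpa using Finset.mem_of_mem_erase (hC h)
    have hy4 : y ∉ C4 := by
      intro h
      have := h4 h
      simp only [Finset.mem_union, Finset.mem_erase] at this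
      tauto
    have hg4 : g ∉ C4 := fun h => by simpa using h4 h
    obtain ⟨C5, h5, h5c, hy5⟩ := ih A C4 x y (hlt _ g (by simp [hgB]) (by
        intro z hz
        rw [Finset.mem_erase]
        rw [Finset.mem_union] at hz
        refine ⟨by rintro rfl; tauto, ?_⟩
        rcases hz with h | h
        · simp [h]
        · exact hsub4 h)) hA h4c hxA hx4 hyA hy4
    refine ⟨C5, h5.trans (Finset.erase_subset_erase _ ?_), h5c, hy5⟩
    exact Finset.union_subset Finset.subset_union_left hsub4

theorem circ_trans_aux {E : Type} [DecidableEq E] (Circ : Finset E → Prop)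
    (anti : ∀ A B, Circ A → Circ B → A ⊆ B → A = B)
    (strong : ∀ A B x y, Circ A → Circ B → x ∈ A → x ∈ B → y ∈ A → y ∉ B →
      ∃ C ⊆ (A ∪ B).erase x, Circ C ∧ y ∈ C) (e f : E) :
    ∀ n : ℕ, ∀ A B x, (A ∪ B).card ≤ n → Circ A → Circ B → e ∈ A → f ∈ B → x ∈ A → x ∈ B →
      ∃ C ⊆ A ∪ B, Circ C ∧ e ∈ C ∧ f ∈ C := by
  intro n
  induction n with
  | zero =>
    intro A B x hn hA hB hxA
    have : (A ∪ B) = ∅ := Finset.card_eq_zero.mp (by omega)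
    have hx : e ∈ A ∪ B := Finset.mem_union_left _ hxA
    simp [this] at hx
  | succ n ih =>
    intro A B x hn hA hB heA hfB hxA hxB
    by_cases hfA : f ∈ A
    · exact ⟨A, Finset.subset_union_left, hA, heA, hfA⟩
    by_cases heB : e ∈ B
    · exact ⟨B, Finset.subset_union_right, hB, heB, hfB⟩
    have key : ∀ P Q : Finset E, Circ P → Circ Q → e ∈ P → f ∈ Q → P ∪ Q ⊆ A ∪ B →
        (∃ z ∈ P, z ∈ Q) → (∃ z ∈ A ∪ B, z ∉ P ∪ Q) →
        ∃ C ⊆ A ∪ B, Circ C ∧ e ∈ C ∧ f ∈ C := by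
      rintro P Q hP hQ heP hfQ hPQ ⟨z, hzP, hzQ⟩ ⟨w, hw, hwn⟩
      have : (P ∪ Q).card < (A ∪ B).card :=
        Finset.card_lt_card ⟨hPQ, fun h => hwn (h hw)⟩
      obtain ⟨C, hC, h⟩ := ih P Q z (by omega) hP hQ heP hfQ hzP hzQ
      exact ⟨C, hC.trans hPQ, h⟩
    obtain ⟨C3, h3, h3c, he3⟩ := strong A B x e hA hB hxA hxB heA heB
    obtain ⟨C4, h4, h4c, hf4⟩ := strong B A x f hB hA hxB hxA hfB hfA
    have h3s : C3 ⊆ A ∪ B := h3.trans (Finset.erase_subset _ _)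
    have h4s : C4 ⊆ A ∪ B := by
      rw [Finset.union_comm]; exact h4.trans (Finset.erase_subset _ _)
    have hx3 : x ∉ C3 := fun h => by simpa using h3 h
    have hx4 : x ∉ C4 := fun h => by simpa using h4 h
    have h3A : ¬ C3 ⊆ A := fun h => hx3 (anti _ _ h3c hA h ▸ hxA)
    obtain ⟨g, hg3, hgA⟩ := Finset.not_subset.mp h3A
    have hgB : g ∈ B := by
      have := h3s hg3
      simp only [Finset.mem_union] at this
      tauto
    have h4B : ¬ C4 ⊆ B := fun h => hx4 (anti _ _ h4c hB h ▸ hxB)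
    obtain ⟨k, hk4, hkB⟩ := Finset.not_subset.mp h4B
    have hkA : k ∈ A := by
      have := h4s hk4
      simp only [Finset.mem_union] at this
      tauto
    by_cases hg4 : g ∈ C4
    · refine key C3 C4 h3c h4c he3 hf4 (Finset.union_subset h3s h4s) ⟨g, hg3, hg4⟩
        ⟨x, by simp [hxA], by simp [hx3, hx4]⟩
    · refine key A C4 hA h4c heA hf4 (Finset.union_subset Finset.subset_union_left h4s)
        ⟨k, hkA, hk4⟩ ⟨g, by simp [hgB], by simp [hgA, hg4]⟩

/-- descent: no circuit inside `F` crosses a separation compatible with `J`. -/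
theorem no_cross_aux {E : Type} [DecidableEq E] (Circ : Finset E → Prop)
    (anti : ∀ A B, Circ A → Circ B → A ⊆ B → A = B)
    (strong : ∀ A B x y, Circ A → Circ B → x ∈ A → x ∈ B → y ∈ A → y ∉ B →
      ∃ C ⊆ (A ∪ B).erase x, Circ C ∧ y ∈ C)
    (F J : Finset E) (S : E → Prop) (hJ : ∀ C, Circ C → ¬ C ⊆ J)
    (hfund : ∀ e ∈ F, e ∉ J → ∃ C ⊆ F, Circ C ∧ e ∈ C ∧ C.erase e ⊆ J ∧ ∀ z ∈ C, (S z ↔ S e)) :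
    ∀ n : ℕ, ∀ C, (C \ J).card ≤ n → Circ C → C ⊆ F → ∀ a ∈ C, ∀ b ∈ C, S a → S b := by
  intro n
  induction n with
  | zero =>
    intro C hn hC
    exact absurd (Finset.sdiff_eq_empty_iff_subset.mp (Finset.card_eq_zero.mp (by omega))) (hJ C hC)
  | succ n ih =>
    intro C hn hC hCF a ha b hb hSa
    by_contra hSb
    obtain ⟨e, heC, heJ⟩ := Finset.not_subset.mp (hJ C hC)
    obtain ⟨C', hC'F, hC', heC', hC'J, hS⟩ := hfund e (hCF heC) heJ
    obtain ⟨y, hyC, hy⟩ : ∃ y ∈ C, ¬ (S y ↔ S e) := by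
      by_cases hSe : S e
      · exact ⟨b, hb, by tauto⟩
      · exact ⟨a, ha, by tauto⟩
    obtain ⟨K, hK, hKc, hyK⟩ := strong C C' e y hC hC' heC heC' hyC (fun h => hy (hS y h))
    have heK : e ∉ K := fun h => by simpa using hK h
    have hKF : K ⊆ F := hK.trans ((Finset.erase_subset _ _).trans (Finset.union_subset hCF hC'F))
    have hcard : (K \ J).card ≤ n := by
      have h1 : K \ J ⊆ (C \ J).erase e := by
        intro z hz
        rw [Finset.mem_sdiff] at hz
        have h2 := hK hz.1
        rw [Finset.mem_erase, Finset.mem_union] at h2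
        rw [Finset.mem_erase, Finset.mem_sdiff]
        refine ⟨h2.1, ?_, hz.2⟩
        rcases h2.2 with h | h
        · exact h
        · exact absurd (hC'J (Finset.mem_erase.mpr ⟨h2.1, h⟩)) hz.2
      have h2 := Finset.card_le_card h1
      rw [Finset.card_erase_of_mem (by simp [heC, heJ])] at h2
      omega
    have hKall := ih K hcard hKc hKF
    have hKC : K ⊆ C := by
      intro z hz
      have h2 := hK hz
      rw [Finset.mem_erase, Finset.mem_union] at h2
      rcases h2.2 with h | h
      · exact h
      · exfalso
        have h3 := hS z h
        have h4 := hKall z hz y hyK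
        have h5 := hKall y hyK z hz
        tauto
    exact heK (anti _ _ hKc hC hKC ▸ heC)

section counts
variable {V E : Type} [Fintype V] {D : ℕ} {π : E → Sym2 V} {R : Finset V}

/-- weight form of the count -/
theorem fCnt_eq_s15 (D : ℕ) (π : E → Sym2 V) (R : Finset V) (F : Finset E) :
    fCnt D π R F = (∑ v ∈ VF π F, ((D : ℤ) - if v ∈ R then 1 else 0)) - D := by
  unfold fCnt
  rw [Finset.sum_sub_distrib, Finset.sum_const, Finset.sum_boole, Finset.filter_mem_eq_inter]
  simp only [nsmul_eq_mul]
  ring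

theorem VF_mono_s15 {A B : Finset E} (h : A ⊆ B) : VF π A ⊆ VF π B := by
  intro v
  simp only [VF, Finset.mem_filter, Finset.mem_univ, true_and]
  rintro ⟨e, he, hv⟩
  exact ⟨e, h he, hv⟩

theorem VF_union_s15 [DecidableEq E] (A B : Finset E) : VF π (A ∪ B) = VF π A ∪ VF π B := by
  ext v
  simp only [VF, Finset.mem_filter, Finset.mem_univ, true_and, Finset.mem_union]
  constructor
  · rintro ⟨e, he | he, hv⟩
    · exact Or.inl ⟨e, he, hv⟩
    · exact Or.inr ⟨e, he, hv⟩
  · rintro (⟨e, he, hv⟩ | ⟨e, he, hv⟩)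
    · exact ⟨e, Or.inl he, hv⟩
    · exact ⟨e, Or.inr he, hv⟩

theorem wt_pos (hD : 6 ≤ D) (v : V) : (5 : ℤ) ≤ (D : ℤ) - if v ∈ R then 1 else 0 := by
  have : (6 : ℤ) ≤ D := by exact_mod_cast hD
  split_ifs <;> omega

theorem fCnt_mono' (hD : 6 ≤ D) {A B : Finset E} (h : VF π A ⊆ VF π B) :
    fCnt D π R A ≤ fCnt D π R B := by
  rw [fCnt_eq_s15, fCnt_eq_s15]
  have := Finset.sum_le_sum_of_subset_of_nonneg (f := fun v => ((D : ℤ) - if v ∈ R then 1 else 0))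
    h (fun v _ _ => by have := wt_pos (R := R) hD v; omega)
  omega

theorem fCnt_strict (hD : 6 ≤ D) {A B : Finset E} (h : VF π A ⊆ VF π B) {v : V}
    (hv : v ∈ VF π B) (hv' : v ∉ VF π A) : fCnt D π R A + 5 ≤ fCnt D π R B := by
  rw [fCnt_eq_s15, fCnt_eq_s15]
  have h1 := Finset.sum_le_sum_of_subset_of_nonneg
    (f := fun v => ((D : ℤ) - if v ∈ R then 1 else 0))
    (Finset.insert_subset hv h) (fun v _ _ => by have := wt_pos (R := R) hD v; omega)
  rw [Finset.sum_insert hv'] at h1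
  have := wt_pos (R := R) hD v
  omega

theorem fCnt_submod [DecidableEq E] (hD : 6 ≤ D) (A B : Finset E) :
    fCnt D π R (A ∪ B) + fCnt D π R (A ∩ B) ≤ fCnt D π R A + fCnt D π R B := by
  simp only [fCnt_eq_s15, VF_union_s15]
  have h1 := Finset.sum_union_inter (s₁ := VF π A) (s₂ := VF π B)
    (f := fun v => ((D : ℤ) - if v ∈ R then 1 else 0))
  have h2 := Finset.sum_le_sum_of_subset_of_nonneg
    (f := fun v => ((D : ℤ) - if v ∈ R then 1 else 0))
    (Finset.subset_inter (VF_mono_s15 (π := π) (Finset.inter_subset_left (s₁ := A) (s₂ := B)))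
      (VF_mono_s15 (π := π) (Finset.inter_subset_right (s₁ := A) (s₂ := B))))
    (fun v _ _ => by have := wt_pos (R := R) hD v; omega)
  omega

theorem fCnt_single (hD : 6 ≤ D) (hπ : ∀ e : E, ¬ (π e).IsDiag) (e : E) :
    1 ≤ fCnt D π R {e} := by
  obtain ⟨a, b, hab⟩ : ∃ a b, π e = s(a, b) := by
    induction h : π e with
    | _ a b => exact ⟨a, b, rfl⟩
  have hne : a ≠ b := by
    have := hπ e
    rw [hab] at this
    simpa using this
  have hV : VF π {e} = {a, b} := by
    ext v
    simp [VF, hab]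
  rw [fCnt_eq_s15, hV, Finset.sum_pair hne]
  have : (6 : ℤ) ≤ D := by exact_mod_cast hD
  split_ifs <;> omega

theorem CIndep.mono {A B : Finset E} (hB : CIndep D π R B) (h : A ⊆ B) : CIndep D π R A :=
  fun F' hF' => hB F' (hF'.trans h)

theorem circ_nonempty {C : Finset E} (hC : CCircuit D π R C) : C.Nonempty := by
  rw [Finset.nonempty_iff_ne_empty]
  rintro rfl
  apply hC.1
  intro F' hF' hne
  rw [Finset.subset_empty.mp hF'] at hne
  simp at hne

theorem circ_gt {C : Finset E} (hC : CCircuit D π R C) : fCnt D π R C < C.card := by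
  by_contra h
  push Not at h
  apply hC.1
  intro F' hF' hne
  rcases eq_or_ne F' C with rfl | hn
  · exact h
  · exact hC.2 F' (Finset.ssubset_iff_subset_ne.mpr ⟨hF', hn⟩) F' subset_rfl hne

theorem circ_erase [DecidableEq E] (hD : 6 ≤ D) (hπ : ∀ e : E, ¬ (π e).IsDiag) {C : Finset E}
    (hC : CCircuit D π R C) {e : E} (he : e ∈ C) :
    (C.erase e).Nonempty ∧ CIndep D π R (C.erase e) ∧
      ((C.erase e).card : ℤ) = fCnt D π R (C.erase e) ∧
      fCnt D π R C = fCnt D π R (C.erase e) ∧ (C.card : ℤ) = fCnt D π R C + 1 ∧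
      VF π C ⊆ VF π (C.erase e) := by
  have hgt := circ_gt hC
  have hi := hC.2 _ (Finset.erase_ssubset he)
  have hne : (C.erase e).Nonempty := by
    rw [Finset.nonempty_iff_ne_empty]
    intro h
    have h2 := Finset.insert_erase he
    rw [h] at h2
    have h1 := fCnt_single (R := R) hD hπ e
    rw [← h2] at hgt
    simp at hgt h1
    omega
  have h1 := hi _ subset_rfl hne
  have h2 : fCnt D π R (C.erase e) ≤ fCnt D π R C := fCnt_mono' hD (VF_mono_s15 (Finset.erase_subset _ _))
  have h3 := Finset.card_erase_add_one he
  refine ⟨hne, hi, by omega, by omega, by omega, ?_⟩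
  by_contra h
  obtain ⟨v, hv, hv'⟩ := Finset.not_subset.mp h
  have := fCnt_strict (R := R) hD (VF_mono_s15 (π := π) (Finset.erase_subset e C)) hv hv'
  omega

theorem exists_circ {A : Finset E} (hA : ¬ CIndep D π R A) : ∃ C ⊆ A, CCircuit D π R C := by
  induction A using Finset.strongInduction with
  | H A ih =>
    by_cases h : ∀ C' ⊂ A, CIndep D π R C'
    · exact ⟨A, subset_rfl, hA, h⟩
    · push Not at h
      obtain ⟨B, hB, hBi⟩ := h
      obtain ⟨C, hC, hc⟩ := ih B hB hBi
      exact ⟨C, hC.trans hB.subset, hc⟩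

theorem circ_anti (A B : Finset E) (hA : CCircuit D π R A) (hB : CCircuit D π R B) (h : A ⊆ B) :
    A = B := by
  by_contra hn
  exact hA.1 (hB.2 A (Finset.ssubset_iff_subset_ne.mpr ⟨h, hn⟩))

theorem circ_weak [DecidableEq E] (hD : 6 ≤ D) (hπ : ∀ e : E, ¬ (π e).IsDiag) (A B : Finset E)
    (x : E) (hA : CCircuit D π R A) (hB : CCircuit D π R B) (hne : A ≠ B)
    (hxA : x ∈ A) (hxB : x ∈ B) : ∃ C ⊆ (A ∪ B).erase x, CCircuit D π R C := by
  apply exists_circ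
  intro hi
  have hsub : A ∩ B ⊂ A := by
    refine Finset.ssubset_iff_subset_ne.mpr ⟨Finset.inter_subset_left, fun h => ?_⟩
    exact hne (circ_anti A B hA hB (Finset.inter_eq_left.mp h))
  have h1 := hA.2 _ hsub _ subset_rfl ⟨x, by simp [hxA, hxB]⟩
  have h2 := fCnt_submod (π := π) (R := R) hD A B
  obtain ⟨⟨y, hy⟩, -, -, -, h3, -⟩ := circ_erase hD hπ hA hxA
  have h4 := (circ_erase hD hπ hB hxB).2.2.2.2.1
  have h5 := Finset.card_union_add_card_inter A B
  have hxU : x ∈ A ∪ B := by simp [hxA]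
  have h6 := Finset.card_erase_add_one hxU
  have h7 := hi _ subset_rfl ⟨y, Finset.erase_subset_erase _ Finset.subset_union_left hy⟩
  have h8 : fCnt D π R ((A ∪ B).erase x) ≤ fCnt D π R (A ∪ B) :=
    fCnt_mono' hD (VF_mono_s15 (Finset.erase_subset _ _))
  omega

theorem circ_strong [DecidableEq E] (hD : 6 ≤ D) (hπ : ∀ e : E, ¬ (π e).IsDiag) (A B : Finset E)
    (x y : E) (hA : CCircuit D π R A) (hB : CCircuit D π R B)
    (hxA : x ∈ A) (hxB : x ∈ B) (hyA : y ∈ A) (hyB : y ∉ B) :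
    ∃ C ⊆ (A ∪ B).erase x, CCircuit D π R C ∧ y ∈ C :=
  strong_elim_aux (CCircuit D π R) circ_anti (circ_weak hD hπ) _ A B x y le_rfl hA hB hxA hxB
    hyA hyB

theorem circ_of_insert [DecidableEq E] {J : Finset E} {e : E} (hJ : CIndep D π R J)
    (h : ¬ CIndep D π R (insert e J)) :
    ∃ C ⊆ insert e J, CCircuit D π R C ∧ e ∈ C ∧ C.erase e ⊆ J := by
  obtain ⟨C, hC, hc⟩ := exists_circ h
  refine ⟨C, hC, hc, ?_, ?_⟩
  · by_contra he
    exact hc.1 (hJ.mono ((Finset.subset_insert_iff_of_notMem he).mp hC))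
  · exact Finset.subset_insert_iff.mp hC

theorem cRank_bdd (F : Finset E) :
    BddAbove {n : ℕ | ∃ F' ⊆ F, CIndep D π R F' ∧ F'.card = n} := by
  refine ⟨F.card, ?_⟩
  rintro n ⟨F', h, -, rfl⟩
  exact Finset.card_le_card h

theorem le_cRank {F I : Finset E} (h : I ⊆ F) (hI : CIndep D π R I) : I.card ≤ cRank D π R F :=
  le_csSup (cRank_bdd F) ⟨I, h, hI, rfl⟩

theorem exists_cRank (F : Finset E) : ∃ I ⊆ F, CIndep D π R I ∧ I.card = cRank D π R F := by
  have : cRank D π R F ∈ {n : ℕ | ∃ F' ⊆ F, CIndep D π R F' ∧ F'.card = n} := by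
    refine Nat.sSup_mem ⟨0, ∅, by simp, ?_, rfl⟩ (cRank_bdd F)
    intro F' hF' hne
    rw [Finset.subset_empty.mp hF'] at hne
    simp at hne
  exact this

theorem max_dep [DecidableEq E] {F J : Finset E} (hJF : J ⊆ F) 
    (hc : J.card = cRank D π R F) {e : E} (he : e ∈ F) (heJ : e ∉ J) :
    ¬ CIndep D π R (insert e J) := by
  intro h
  have := le_cRank (Finset.insert_subset he hJF) h
  rw [Finset.card_insert_of_notMem heJ] at this
  omega

/-- the rank of a nontrivial M-connected set is its count -/
theorem rank_conn [DecidableEq E] (hD : 6 ≤ D) (hπ : ∀ e : E, ¬ (π e).IsDiag) {F : Finset E}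
    (hF : F.Nonempty)
    (hconn : ∀ e ∈ F, ∀ e' ∈ F, ∃ C ⊆ F, CCircuit D π R C ∧ e ∈ C ∧ e' ∈ C) :
    fCnt D π R F ≤ cRank D π R F := by
  obtain ⟨J, hJF, hJ, hJc⟩ := exists_cRank (D := D) (π := π) (R := R) F
  have hfund : ∀ e ∈ F, e ∉ J → ∃ C ⊆ insert e J, CCircuit D π R C ∧ e ∈ C ∧ C.erase e ⊆ J :=
    fun e he heJ => circ_of_insert hJ (max_dep hJF hJc he heJ)
  obtain ⟨x0, hx0⟩ := hF
  obtain ⟨C0, hC0F, hC0, -, -⟩ := hconn x0 hx0 x0 hx0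
  obtain ⟨e0, he0C, he0J⟩ := Finset.not_subset.mp (fun h => hC0.1 (hJ.mono h))
  obtain ⟨C1, hC1, hC1c, he1, hC1J⟩ := hfund e0 (hC0F he0C) he0J
  have h1 := circ_erase hD hπ hC1c he1
  -- a maximum tight set
  obtain ⟨T, hT, hTmax⟩ := Finset.exists_max_image
    (J.powerset.filter (fun T => T.Nonempty ∧ (T.card : ℤ) = fCnt D π R T)) Finset.card
    ⟨C1.erase e0, by
      rw [Finset.mem_filter, Finset.mem_powerset]
      exact ⟨hC1J, h1.1, h1.2.2.1⟩⟩
  rw [Finset.mem_filter, Finset.mem_powerset] at hT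
  obtain ⟨hTJ, ⟨t, ht⟩, hTt⟩ := hT
  have habs : ∀ T' ⊆ J, (T'.card : ℤ) = fCnt D π R T' → (∃ z ∈ T', z ∈ T) → T' ⊆ T := by
    rintro T' hT'J hT't ⟨z, hz, hz'⟩
    have h2 := fCnt_submod (π := π) (R := R) hD T T'
    have h3 := hJ (T ∩ T') (Finset.inter_subset_left.trans hTJ) ⟨z, by simp [hz, hz']⟩
    have h4 := hJ (T ∪ T') (Finset.union_subset hTJ hT'J) ⟨z, by simp [hz]⟩
    have h5 := Finset.card_union_add_card_inter T T'
    have h6 := hTmax (T ∪ T') (by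
      rw [Finset.mem_filter, Finset.mem_powerset]
      exact ⟨Finset.union_subset hTJ hT'J, ⟨z, by simp [hz]⟩, by omega⟩)
    have h7 := Finset.eq_of_subset_of_card_le (Finset.subset_union_left (s₁ := T) (s₂ := T')) h6
    exact Finset.union_eq_left.mp h7.symm
  let S : E → Prop := fun x => x ∈ T ∨ (x ∉ J ∧ ¬ CIndep D π R (insert x T))
  have hall : ∀ x ∈ F, S x := by
    intro x hx
    obtain ⟨C, hCF, hC, htC, hxC⟩ := hconn t (hJF (hTJ ht)) x hx
    refine no_cross_aux (CCircuit D π R) circ_anti (circ_strong hD hπ) F J S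
      (fun C hC h => hC.1 (hJ.mono h)) ?_ _ C le_rfl hC hCF t htC x hxC (Or.inl ht)
    intro e he heJ
    by_cases hSe : S e
    · have hdep : ¬ CIndep D π R (insert e T) := by
        rcases hSe with h | h
        · exact absurd (hTJ h) heJ
        · exact h.2
      obtain ⟨C', hC', hc', he', hC'T⟩ := circ_of_insert (hJ.mono hTJ) hdep
      refine ⟨C', hC'.trans (Finset.insert_subset he (hTJ.trans hJF)), hc', he',
        hC'T.trans hTJ, ?_⟩
      intro z hz
      refine ⟨fun _ => hSe, fun _ => ?_⟩
      rcases Finset.mem_insert.mp (hC' hz) with rfl | h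
      · exact hSe
      · exact Or.inl h
    · obtain ⟨C', hC', hc', he', hC'J⟩ := hfund e he heJ
      refine ⟨C', hC'.trans (Finset.insert_subset he hJF), hc', he', hC'J, ?_⟩
      intro z hz
      refine ⟨fun hSz => ?_, fun h => absurd h hSe⟩
      exfalso
      by_cases hze : z = e
      · exact hSe (hze ▸ hSz)
      have hzE : z ∈ C'.erase e := Finset.mem_erase.mpr ⟨hze, hz⟩
      have hzT : z ∈ T := by
        rcases hSz with h | h
        · exact h
        · exact absurd (hC'J hzE) h.1
      have hsub := habs _ hC'J (circ_erase hD hπ hc' he').2.2.1 ⟨z, hzE, hzT⟩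
      exact hSe (Or.inr ⟨heJ, fun h => hc'.1 (h.mono (Finset.subset_insert_iff.mpr hsub))⟩)
  have hVF : VF π F ⊆ VF π T := by
    intro v hv
    simp only [VF, Finset.mem_filter, Finset.mem_univ, true_and] at hv
    obtain ⟨x, hx, hvx⟩ := hv
    rcases hall x hx with h | ⟨-, h⟩
    · simp only [VF, Finset.mem_filter, Finset.mem_univ, true_and]
      exact ⟨x, h, hvx⟩
    · obtain ⟨C', hC', hc', he', hC'T⟩ := circ_of_insert (hJ.mono hTJ) h
      refine VF_mono_s15 hC'T ((circ_erase hD hπ hc' he').2.2.2.2.2 ?_)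
      simp only [VF, Finset.mem_filter, Finset.mem_univ, true_and]
      exact ⟨x, he', hvx⟩
  have h8 : fCnt D π R F ≤ fCnt D π R T := fCnt_mono' hD hVF
  have h9 := Finset.card_le_card hTJ
  omega

end counts

theorem statement_15
    (V E : Type) [Fintype V] [Fintype E] [DecidableEq V] [DecidableEq E]
    (π : E → Sym2 V) (hπ : ∀ e : E, ¬ (π e).IsDiag)
    (B R : Finset V) (hdisj : Disjoint B R) (hcov : B ∪ R = Finset.univ)
    (d D : ℕ) (hd : 3 ≤ d) (hD : D = (d + 1).choose 2)
    (F : Finset E) (hF2 : 2 ≤ F.card) (hconn : MConn D π R F) :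
    (∀ e : E, cRank D π R (insert e F) = cRank D π R F ↔ ∀ v ∈ π e, v ∈ VF π F) ∧
    (MConnComp D π R Finset.univ F →
      ∀ e : E, (∀ v ∈ π e, v ∈ VF π F) → e ∈ F) := by
  have hD6 : 6 ≤ D := by
    rw [hD]
    calc 6 = (3 + 1).choose 2 := by decide
      _ ≤ (d + 1).choose 2 := Nat.choose_le_choose 2 (by omega)
  have hc : ∀ e ∈ F, ∀ e' ∈ F, ∃ C ⊆ F, CCircuit D π R C ∧ e ∈ C ∧ e' ∈ C := by
    rcases hconn with h | h
    · omega
    · exact h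
  have hFne : F.Nonempty := Finset.card_pos.mp (by omega)
  have hrank := rank_conn hD6 hπ hFne hc
  have hfwd : ∀ e : E, (∀ v ∈ π e, v ∈ VF π F) →
      cRank D π R (insert e F) = cRank D π R F := by
    intro e he
    apply le_antisymm
    · obtain ⟨I, hIF, hI, hIc⟩ := exists_cRank (D := D) (π := π) (R := R) (insert e F)
      rw [← hIc]
      rcases I.eq_empty_or_nonempty with rfl | hne
      · simp
      have h1 := hI I subset_rfl hne
      have h2 : fCnt D π R I ≤ fCnt D π R F := by
        apply fCnt_mono' hD6
        intro v hv
        simp only [VF, Finset.mem_filter, Finset.mem_univ, true_and] at hv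
        obtain ⟨x, hx, hvx⟩ := hv
        rcases Finset.mem_insert.mp (hIF hx) with rfl | h
        · exact he v hvx
        · simp only [VF, Finset.mem_filter, Finset.mem_univ, true_and]
          exact ⟨x, h, hvx⟩
      omega
    · obtain ⟨I, hIF, hI, hIc⟩ := exists_cRank (D := D) (π := π) (R := R) F
      rw [← hIc]
      exact le_cRank (hIF.trans (Finset.subset_insert _ _)) hI
  refine ⟨fun e => ⟨fun heq => ?_, hfwd e⟩, ?_⟩
  · by_contra hv
    push Not at hv
    obtain ⟨v, hve, hvF⟩ := hv
    have heF : e ∉ F := by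
      intro h
      apply hvF
      simp only [VF, Finset.mem_filter, Finset.mem_univ, true_and]
      exact ⟨e, h, hve⟩
    obtain ⟨I, hIF, hI, hIc⟩ := exists_cRank (D := D) (π := π) (R := R) F
    refine max_dep (J := I) (hIF.trans (Finset.subset_insert e F)) (hIc.trans heq.symm)
      (Finset.mem_insert_self e F) (fun h => heF (hIF h)) ?_
    by_contra hdep
    obtain ⟨C, hC, hcc, heC, hCI⟩ := circ_of_insert hI hdep
    apply hvF
    refine VF_mono_s15 (hCI.trans hIF) ((circ_erase hD6 hπ hcc heC).2.2.2.2.2 ?_)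
    simp only [VF, Finset.mem_filter, Finset.mem_univ, true_and]
    exact ⟨e, heC, hve⟩
  · rintro ⟨-, -, hmax⟩ e he
    by_contra heF
    have heq := hfwd e he
    obtain ⟨I, hIF, hI, hIc⟩ := exists_cRank (D := D) (π := π) (R := R) F
    obtain ⟨C, hC, hcc, heC, hCI⟩ := circ_of_insert hI
      (max_dep (J := I) (hIF.trans (Finset.subset_insert e F)) (hIc.trans heq.symm)
        (Finset.mem_insert_self e F) (fun h => heF (hIF h)))
    have hCF : C ⊆ insert e F := hC.trans (Finset.insert_subset_insert e hIF)
    obtain ⟨x, hx⟩ := (circ_erase hD6 hπ hcc heC).1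
    have hxC := Finset.mem_of_mem_erase hx
    have hxF := hIF (hCI hx)
    have hpair : ∀ b ∈ F, ∃ K ⊆ insert e F, CCircuit D π R K ∧ e ∈ K ∧ b ∈ K := by
      intro b hb
      obtain ⟨C2, hC2, hc2, hx2, hb2⟩ := hc x hxF b hb
      obtain ⟨K, hK, h⟩ := circ_trans_aux (CCircuit D π R) circ_anti (circ_strong hD6 hπ) e b _
        C C2 x le_rfl hcc hc2 heC hb2 hxC hx2
      exact ⟨K, hK.trans (Finset.union_subset hCF (hC2.trans (Finset.subset_insert _ _))), h⟩
    have := hmax (insert e F) (Finset.subset_univ _) (Or.inr (by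
      intro a ha b hb
      rcases Finset.mem_insert.mp ha with rfl | haF
      · rcases Finset.mem_insert.mp hb with rfl | hb
        · exact ⟨C, hCF, hcc, heC, heC⟩
        · exact hpair b hb
      · rcases Finset.mem_insert.mp hb with rfl | hb
        · obtain ⟨K, h1, h2, h3, h4⟩ := hpair a haF
          exact ⟨K, h1, h2, h4, h3⟩
        · obtain ⟨K, h1, h2⟩ := hc a haF b hb
          exact ⟨K, h1.trans (Finset.subset_insert _ _), h2⟩)) (Finset.subset_insert _ _)
    exact heF (this ▸ Finset.mem_insert_self e F)
end
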